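/- arXiv:0706.3750 — 2 statements merged into one kernel-verified Lean document; each statement's English description precedes it below -/
import Mathlib

section
/- Let E be a finite nonempty set and let C be any family of rooted sets in E. Let N(C) be the collection of full subsets of E that are accessible from E within the collection of full sets. Then N(C) is the collection of closed sets of a convex geometry on E; that is, N(C) satisfies: (N1) E ∈ N(C); (N2) if A, B ∈ N(C) then A ∩ B ∈ N(C); (N3) for every A ∈ N(C) with A ≠ E there is an x ∉ A such that A ∪ {x} ∈ N(C). -/
/-- `S` is full with respect to the family `C` of rooted sets. -/
def IsFull {α : Type*} [DecidableEq α] (C : Set (Finset α × α)) (S : Finset α) : Prop :=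
  ∀ p ∈ C, p.1.erase p.2 ⊆ S → p.2 ∈ S

/-- `A` is accessible from `B` within the collection `F`: there is a chain
`B = S_0 ⊋ S_1 ⊋ ⋯ ⊋ S_k = A` of members of `F` with `|S_i \ S_{i+1}| = 1`. -/
def AccessibleFrom {α : Type*} [DecidableEq α] (F : Set (Finset α)) (B A : Finset α) : Prop :=
  ∃ (k : ℕ) (S : ℕ → Finset α), S 0 = B ∧ S k = A ∧ (∀ i ≤ k, S i ∈ F) ∧
    ∀ i < k, S (i + 1) ⊆ S i ∧ (S i \ S (i + 1)).card = 1

/-- The collection of full sets accessible from the ground set `univ`. -/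
def NC {α : Type*} [Fintype α] [DecidableEq α] (C : Set (Finset α × α)) : Set (Finset α) :=
  {S | IsFull C S ∧ AccessibleFrom {T | IsFull C T} Finset.univ S}

theorem NC_step {α : Type*} [Fintype α] [DecidableEq α] (C : Set (Finset α × α))
    (T U : Finset α) (hT : T ∈ NC C) (hU : IsFull C U) (hs : U ⊆ T)
    (hc : (T \ U).card = 1) : U ∈ NC C := by
  obtain ⟨-, k, S, h0, hk, hF, hS⟩ := hT
  refine ⟨hU, k + 1, fun i => if i ≤ k then S i else U, by simpa using h0, by simp, ?_, ?_⟩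
  · intro i hi
    by_cases h : i ≤ k
    · simpa [h] using hF i h
    · simpa [h] using hU
  · intro i hi
    by_cases h : i < k
    · have h1 : i + 1 ≤ k := h
      have h2 : i ≤ k := h.le
      simp only [h1, h2, if_true]
      exact hS i h
    · have h1 : i = k := by omega
      subst h1
      simp only [le_refl, if_true, Nat.not_succ_le_self, if_false, hk]
      exact ⟨hs, hc⟩

theorem full_inter {α : Type*} [DecidableEq α] (C : Set (Finset α × α))
    (A B : Finset α) (hA : IsFull C A) (hB : IsFull C B) : IsFull C (A ∩ B) := by
  intro p hp h
  rw [Finset.subset_inter_iff] at h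
  exact Finset.mem_inter.2 ⟨hA p hp h.1, hB p hp h.2⟩

theorem stmt_7 {α : Type*} [Fintype α] [DecidableEq α] [Nonempty α]
    (C : Set (Finset α × α)) (hC : ∀ p ∈ C, p.2 ∈ p.1) :
    Finset.univ ∈ NC C ∧
    (∀ A ∈ NC C, ∀ B ∈ NC C, A ∩ B ∈ NC C) ∧
    (∀ A ∈ NC C, A ≠ Finset.univ → ∃ x ∉ A, insert x A ∈ NC C) := by
  refine ⟨⟨fun _ _ _ => Finset.mem_univ _, 0, fun _ => Finset.univ, rfl, rfl,
    fun _ _ _ _ _ => Finset.mem_univ _, fun i hi => absurd hi (Nat.not_lt_zero _)⟩, ?_, ?_⟩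
  · rintro A hA B ⟨-, k, S, h0, hk, hF, hS⟩
    have key : ∀ i ≤ k, A ∩ S i ∈ NC C := by
      intro i
      induction i with
      | zero => intro _; simpa [h0] using hA
      | succ n ih =>
        intro hn
        have h1 := ih (by omega)
        obtain ⟨hs, hc⟩ := hS n (by omega)
        have hf := full_inter C A (S (n + 1)) hA.1 (hF _ hn)
        have hsub : A ∩ S (n + 1) ⊆ A ∩ S n := Finset.inter_subset_inter_left hs
        have hle : ((A ∩ S n) \ (A ∩ S (n + 1))).card ≤ 1 := by
          refine le_trans (Finset.card_le_card ?_) hc.le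
          intro x hx
          simp only [Finset.mem_sdiff, Finset.mem_inter] at hx ⊢
          tauto
        rcases Nat.le_one_iff_eq_zero_or_eq_one.1 hle with h | h
        · rw [Finset.card_eq_zero, Finset.sdiff_eq_empty_iff_subset] at h
          rw [Finset.Subset.antisymm hsub h]
          exact h1
        · exact NC_step C _ _ h1 hf hsub h
    rw [← hk]
    exact key k le_rfl
  · rintro A ⟨-, k, S, h0, hk, hF, hS⟩ hne
    cases k with
    | zero => exact absurd (hk.symm.trans h0) hne
    | succ n =>
      obtain ⟨hs, hc⟩ := hS n (by omega)
      rw [hk] at hs hc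
      obtain ⟨x, hx⟩ := Finset.card_eq_one.1 hc
      have hxm : x ∈ S n \ A := by simp [hx]
      refine ⟨x, (Finset.mem_sdiff.1 hxm).2, ?_⟩
      have he : insert x A = S n := by
        rw [← Finset.sdiff_union_of_subset hs, hx, Finset.insert_eq]
      rw [he]
      exact ⟨hF n (by omega), n, S, h0, rfl, fun i hi => hF i (by omega),
        fun i hi => hS i (by omega)⟩
end

section
/- Let E be a finite nonempty set and let C be a family of rooted sets in E each of size 2. Then the convex geometry N(C) generated by C (the full sets accessible from E) is closed under both pairwise union and pairwise intersection: for all A, B ∈ N(C), A ∪ B ∈ N(C) and A ∩ B ∈ N(C); hence N(C), ordered by inclusion, is a distributive lattice. -/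
theorem acc_step {α : Type*} [DecidableEq α] {F : Set (Finset α)} {X A B : Finset α}
    (h : AccessibleFrom F X A) (hB : B ∈ F) (hs : B ⊆ A) (hc : (A \ B).card = 1) :
    AccessibleFrom F X B := by
  obtain ⟨k, S, h0, hk, hF, hst⟩ := h
  refine ⟨k + 1, fun i => if i ≤ k then S i else B, by simpa using h0, by simp, ?_, ?_⟩
  · intro i hi
    by_cases h : i ≤ k
    · simpa [h] using hF i h
    · simpa [h] using hB
  · intro i hi
    have h1 : i ≤ k := by omega
    by_cases h : i + 1 ≤ k
    · simpa [h, h1] using hst i (by omega)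
    · have h2 : i = k := by omega
      subst h2
      simpa [hk] using And.intro hs hc

theorem acc_map {α : Type*} [DecidableEq α] {F : Set (Finset α)} {X A B : Finset α}
    (f : Finset α → Finset α) (hf : ∀ T ∈ F, f T ∈ F) (hm : ∀ T U, T ⊆ U → f T ⊆ f U)
    (hd : ∀ T U, f U \ f T ⊆ U \ T)
    (h : AccessibleFrom F B A) (hX : AccessibleFrom F X (f B)) :
    AccessibleFrom F X (f A) := by
  obtain ⟨k, S, h0, hk, hF, hst⟩ := h
  have key : ∀ i ≤ k, AccessibleFrom F X (f (S i)) := by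
    intro i
    induction i with
    | zero => intro _; rw [h0]; exact hX
    | succ i ih =>
      intro hi
      have ih' := ih (by omega)
      obtain ⟨hs, hc⟩ := hst i (by omega)
      have hle := Finset.card_le_card (hd (S (i+1)) (S i))
      have hsub := hm _ _ hs
      by_cases h1 : (f (S i) \ f (S (i+1))).card = 1
      · exact acc_step ih' (hf _ (hF _ hi)) hsub h1
      · have h2 : (f (S i) \ f (S (i+1))).card = 0 := by omega
        rw [Finset.card_eq_zero, Finset.sdiff_eq_empty_iff_subset] at h2
        rwa [Finset.Subset.antisymm hsub h2]
  rw [← hk]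
  exact key k le_rfl

theorem stmt_13 {α : Type*} [Fintype α] [DecidableEq α] [Nonempty α]
    (C : Set (Finset α × α)) (hC : ∀ p ∈ C, p.2 ∈ p.1) (hC2 : ∀ p ∈ C, p.1.card = 2) :
    ∀ A ∈ NC C, ∀ B ∈ NC C, A ∪ B ∈ NC C ∧ A ∩ B ∈ NC C := by
  intro A hA B hB
  have full_iff : ∀ p ∈ C, ∃ b, p.1.erase p.2 = {b} := by
    intro p hp
    rw [← Finset.card_eq_one, Finset.card_erase_of_mem (hC p hp), hC2 p hp]
  have hU : ∀ S T, IsFull C S → IsFull C T → IsFull C (S ∪ T) := by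
    intro S T hS hT p hp h
    obtain ⟨b, hb⟩ := full_iff p hp
    have h1 := hS p hp
    have h2 := hT p hp
    rw [hb, Finset.singleton_subset_iff] at h h1 h2
    rw [Finset.mem_union] at h ⊢
    exact h.imp h1 h2
  have hI : ∀ S T, IsFull C S → IsFull C T → IsFull C (S ∩ T) := by
    intro S T hS hT p hp h
    rw [Finset.subset_inter_iff] at h
    exact Finset.mem_inter.2 ⟨hS p hp h.1, hT p hp h.2⟩
  refine ⟨⟨hU _ _ hA.1 hB.1, ?_⟩, ⟨hI _ _ hA.1 hB.1, ?_⟩⟩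
  · refine acc_map (fun T => T ∪ B) (fun T hT => hU _ _ hT hB.1)
      (fun T U h => Finset.union_subset_union h (Finset.Subset.refl _)) ?_ hA.2 ?_
    · intro T U x; simp; tauto
    · refine ⟨0, fun _ => Finset.univ, rfl, by simp, ?_, by simp⟩
      intro i _ p _ _
      simp
  · refine acc_map (fun T => A ∩ T) (fun T hT => hI _ _ hA.1 hT)
      (fun T U h => Finset.inter_subset_inter (Finset.Subset.refl _) h) ?_ hB.2 ?_
    · intro T U x; simp; tauto
    · simpa using hA.2
end
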